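/- arXiv:2511.17380 — 2 statements merged into one kernel-verified Lean document; each statement's English description precedes it below -/
import Mathlib

section
/- Let h : ℝ^d → Y be a measurable classifier into a finite label set Y, let B ⊆ ℝ^d be a nonempty measurable perturbation budget, and let (x,y) ∈ ℝ^d × Y. Suppose the adversarial set A = {ε ∈ B : h(x+ε) ≠ y} is nonempty but has Lebesgue measure zero. Then for every probability measure ω on ℝ^d that is absolutely continuous with respect to Lebesgue measure and satisfies ω(B) = 1, one has ω({ε : h(x+ε) = y}) = 1; consequently, if P is any nonempty family of such absolutely continuous probability measures, the strict inequality ⨅_{ε ∈ B} 1[h(x+ε) = y] = 0 < 1 = ⨅_{ω ∈ P} ω({ε : h(x+ε) = y}) holds, i.e. adversarial robustness is strictly smaller than non-parametric probabilistic robustness. -/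
open MeasureTheory
open scoped ENNReal

/-- if the adversarial set `A = {ε ∈ B | h (x+ε) ≠ y}` is nonempty but has
Lebesgue measure zero, then every absolutely continuous probability measure supported in
`B` gives `ω {ε | h (x+ε) = y} = 1`; consequently for any nonempty family `P` of such
measures, the adversarial robustness is `0` while the non-parametric probabilistic
robustness is `1`, i.e. AR < NPPR strictly. -/
theorem ar_lt_nppr_of_null_adversarial_set {d : ℕ} {Y : Type*} [Fintype Y] [Nonempty Y]
    [DecidableEq Y] [MeasurableSpace Y]
    (h : (Fin d → ℝ) → Y) (hh : Measurable h)
    (B : Set (Fin d → ℝ)) (hBne : B.Nonempty) (hBm : MeasurableSet B)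
    (x : Fin d → ℝ) (y : Y)
    (hAne : ({ε ∈ B | h (x + ε) ≠ y}).Nonempty)
    (hAnull : volume {ε ∈ B | h (x + ε) ≠ y} = 0) :
    (∀ ω : Measure (Fin d → ℝ), IsProbabilityMeasure ω → ω ≪ volume → ω B = 1 →
        ω {ε | h (x + ε) = y} = 1) ∧
      ∀ P : Set (Measure (Fin d → ℝ)), P.Nonempty →
        (∀ ω ∈ P, IsProbabilityMeasure ω) → (∀ ω ∈ P, ω ≪ volume) → (∀ ω ∈ P, ω B = 1) →
        (⨅ ε ∈ B, (if h (x + ε) = y then (1 : ℝ≥0∞) else 0)) = 0 ∧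
          (⨅ ω ∈ P, ω {ε | h (x + ε) = y}) = 1 := by
  have key : ∀ ω : Measure (Fin d → ℝ), IsProbabilityMeasure ω → ω ≪ volume → ω B = 1 →
      ω {ε | h (x + ε) = y} = 1 := by
    intro ω hω hac hB
    refine le_antisymm prob_le_one ?_
    have hsub : B ⊆ {ε | h (x + ε) = y} ∪ {ε ∈ B | h (x + ε) ≠ y} := fun ε hε =>
      (em (h (x + ε) = y)).imp id fun hne => ⟨hε, hne⟩
    calc
      1 = ω B := hB.symm
      _ ≤ ω {ε | h (x + ε) = y} + ω {ε ∈ B | h (x + ε) ≠ y} :=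
        (measure_mono hsub).trans (measure_union_le _ _)
      _ = ω {ε | h (x + ε) = y} := by rw [hac hAnull, add_zero]
  refine ⟨key, fun P hP hprob hac hB => ⟨?_, ?_⟩⟩
  · obtain ⟨ε, hε, hne⟩ := hAne
    exact le_antisymm ((iInf₂_le ε hε).trans_eq (if_neg hne)) zero_le
  · exact (biInf_congr fun ω hω => key ω (hprob ω hω) (hac ω hω) (hB ω hω)).trans
      (biInf_const hP)
end

section
/- Let h : ℝ^d → Y be a measurable classifier into a finite label set Y, let B ⊆ ℝ^d be a nonempty measurable perturbation budget, let D be a probability measure on ℝ^d × Y, and let P be a nonempty family of probability measures on ℝ^d, each absolutely continuous with respect to Lebesgue measure and satisfying ω(B) = 1. Assume that for D-almost every (x,y) the adversarial set A(x,y) = {ε ∈ B : h(x+ε) ≠ y} has Lebesgue measure zero, that the set of pairs (x,y) for which A(x,y) is nonempty has positive D-measure, and that the functions (x,y) ↦ ⨅_{ε ∈ B} 1[h(x+ε) = y] and (x,y) ↦ ⨅_{ω ∈ P} ω({ε : h(x+ε) = y}) are measurable. Then the global metrics satisfy the strict inequality G_AR < G_NPPR; indeed G_NPPR = 1 while G_AR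 < 1. -/
open MeasureTheory
open scoped ENNReal

/-- if for `D`-almost every pair the adversarial set is Lebesgue-null,
while pairs with a nonempty adversarial set have positive `D`-measure, and `P` is a
nonempty family of absolutely continuous probability measures supported in `B`, then
the global metrics satisfy `G_AR < G_NPPR`; indeed `G_NPPR = 1` while `G_AR < 1`. -/
theorem global_ar_lt_nppr {d : ℕ} {Y : Type*} [Fintype Y] [Nonempty Y]
    [DecidableEq Y] [MeasurableSpace Y]
    (h : (Fin d → ℝ) → Y) (hh : Measurable h)
    (B : Set (Fin d → ℝ)) (hBne : B.Nonempty) (hBm : MeasurableSet B)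
    (P : Set (Measure (Fin d → ℝ))) (hPne : P.Nonempty)
    (hPprob : ∀ ω ∈ P, IsProbabilityMeasure ω)
    (hPac : ∀ ω ∈ P, ω ≪ volume)
    (hPB : ∀ ω ∈ P, ω B = 1)
    (D : Measure ((Fin d → ℝ) × Y)) [IsProbabilityMeasure D]
    (hae : ∀ᵐ p ∂D, volume {ε ∈ B | h (p.1 + ε) ≠ p.2} = 0)
    (hpos : 0 < D {p : (Fin d → ℝ) × Y | ({ε ∈ B | h (p.1 + ε) ≠ p.2}).Nonempty})
    (hARmeas : Measurable fun p : (Fin d → ℝ) × Y =>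
      ⨅ ε ∈ B, (if h (p.1 + ε) = p.2 then (1 : ℝ≥0∞) else 0))
    (hNPPRmeas : Measurable fun p : (Fin d → ℝ) × Y =>
      ⨅ ω ∈ P, ω {ε | h (p.1 + ε) = p.2}) :
    (∫⁻ p : (Fin d → ℝ) × Y,
        (⨅ ε ∈ B, (if h (p.1 + ε) = p.2 then (1 : ℝ≥0∞) else 0)) ∂D) <
        (∫⁻ p : (Fin d → ℝ) × Y, (⨅ ω ∈ P, ω {ε | h (p.1 + ε) = p.2}) ∂D) ∧
      (∫⁻ p : (Fin d → ℝ) × Y, (⨅ ω ∈ P, ω {ε | h (p.1 + ε) = p.2}) ∂D) = 1 ∧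
        (∫⁻ p : (Fin d → ℝ) × Y,
          (⨅ ε ∈ B, (if h (p.1 + ε) = p.2 then (1 : ℝ≥0∞) else 0)) ∂D) < 1 := by
  have hAR_le (p : (Fin d → ℝ) × Y) :
      (⨅ ε ∈ B, (if h (p.1 + ε) = p.2 then (1 : ℝ≥0∞) else 0)) ≤ 1 := by
    obtain ⟨ε, hε⟩ := hBne
    refine (iInf₂_le ε hε).trans ?_
    split_ifs <;> simp
  have hNPPR : (∫⁻ p : (Fin d → ℝ) × Y, (⨅ ω ∈ P, ω {ε | h (p.1 + ε) = p.2}) ∂D) = 1 := by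
    have hae_one : (fun p : (Fin d → ℝ) × Y => ⨅ ω ∈ P, ω {ε | h (p.1 + ε) = p.2})
        =ᵐ[D] fun _ => 1 := by
      filter_upwards [hae] with p hp
      refine le_antisymm ?_ (le_iInf₂ fun ω hω => ?_)
      · obtain ⟨ω, hω⟩ := hPne
        have := hPprob ω hω
        exact (iInf₂_le ω hω).trans prob_le_one
      · calc
          (1 : ℝ≥0∞) = ω B := (hPB ω hω).symm
          _ ≤ ω ({ε | h (p.1 + ε) = p.2} ∪ {ε ∈ B | h (p.1 + ε) ≠ p.2}) :=
            measure_mono fun ε hε => (em (h (p.1 + ε) = p.2)).imp id fun hne => ⟨hε, hne⟩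
          _ ≤ ω {ε | h (p.1 + ε) = p.2} + ω {ε ∈ B | h (p.1 + ε) ≠ p.2} :=
            measure_union_le _ _
          _ = ω {ε | h (p.1 + ε) = p.2} := by rw [hPac ω hω hp, add_zero]
    rw [lintegral_congr_ae hae_one]
    simp
  have hAR : (∫⁻ p : (Fin d → ℝ) × Y,
      (⨅ ε ∈ B, (if h (p.1 + ε) = p.2 then (1 : ℝ≥0∞) else 0)) ∂D) < 1 := by
    have hle := lintegral_mono (μ := D) hAR_le
    rw [lintegral_one, measure_univ] at hle
    refine lt_of_le_of_ne hle fun heq => hpos.ne' ?_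
    have hae_one := ae_eq_of_ae_le_of_lintegral_le (μ := D) (ae_of_all _ hAR_le)
      (by simp [heq]) aemeasurable_const (by simp [heq])
    refine measure_mono_null ?_ (ae_iff.1 hae_one)
    rintro p ⟨ε, hε, hne⟩ hp
    have hzero := iInf₂_le (f := fun ε (_ : ε ∈ B) =>
      if h (p.1 + ε) = p.2 then (1 : ℝ≥0∞) else 0) ε hε
    beta_reduce at hp
    rw [hp, if_neg hne] at hzero
    exact one_ne_zero (le_antisymm hzero zero_le_one)
  exact ⟨hAR.trans_eq hNPPR.symm, hNPPR, hAR⟩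
end
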